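/- For every n ≥ 0 and every index j with 0 ≤ j ≤ n, there is no tuple of integers (k_i)_{0 ≤ i ≤ n, i ≠ j} with 0 ≤ k_i ≤ s_i − 2 for all i ≠ j such that ∑_{0 ≤ i ≤ n, i ≠ j} k_i d_{n,i} = d_{n,j} + 1. -/

import Mathlib

/-- The Sylvester sequence: `s 0 = 2`, `s (n+1) = 1 + s 0 * s 1 * ⋯ * s n`. -/
def syl : ℕ → ℕ
  | 0 => 2
  | n + 1 => 1 + ∏ k ∈ (Finset.range (n + 1)).attach, syl k.1
decreasing_by exact Finset.mem_range.mp k.2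

/-- `d n = ∏_{k=0}^{n} s k`. -/
def dS (n : ℕ) : ℕ := ∏ k ∈ Finset.range (n + 1), syl k

/-- `d⟨n,j⟩ = d n / s j`. -/
def dSj (n j : ℕ) : ℕ := dS n / syl j

theorem syl_succ (n : ℕ) : syl (n + 1) = 1 + dS n := by
  rw [syl, dS, Finset.prod_attach (Finset.range (n + 1)) syl]

theorem dS_succ (n : ℕ) : dS (n + 1) = dS n * syl (n + 1) :=
  Finset.prod_range_succ _ _

theorem two_le_syl_and_dS_pos (n : ℕ) : 2 ≤ syl n ∧ 0 < dS n := by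
  induction n with
  | zero => simp [dS, syl]
  | succ n ih =>
    have h := syl_succ n
    refine ⟨by omega, ?_⟩
    rw [dS_succ]
    exact Nat.mul_pos ih.2 (by omega)

theorem syl_pos (n : ℕ) : 0 < syl n := by
  have := (two_le_syl_and_dS_pos n).1
  omega

theorem syl_dvd_dS {n i : ℕ} (h : i ≤ n) : syl i ∣ dS n :=
  Finset.dvd_prod_of_mem syl (Finset.mem_range.2 (by omega))

theorem dSj_eq_prod_erase {n i : ℕ} (h : i ≤ n) :
    dSj n i = ∏ k ∈ (Finset.range (n + 1)).erase i, syl k := by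
  rw [dSj, dS, ← Finset.mul_prod_erase _ syl (Finset.mem_range.2 (by omega : i < n + 1)),
    Nat.mul_div_cancel_left _ (syl_pos i)]

theorem syl_dvd_dSj {n i m : ℕ} (hi : i ≤ n) (hm : m ≤ n) (h : i ≠ m) :
    syl i ∣ dSj n m := by
  rw [dSj_eq_prod_erase hm]
  exact Finset.dvd_prod_of_mem syl
    (Finset.mem_erase.2 ⟨h, Finset.mem_range.2 (by omega)⟩)

theorem syl_dvd_dSj_self_add_one {n i : ℕ} (h : i ≤ n) : syl i ∣ dSj n i + 1 := by
  induction n, h using Nat.le_induction with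
  | base =>
    cases i with
    | zero => simp [dSj, dS, syl]
    | succ i =>
      rw [dSj, dS_succ, Nat.mul_div_cancel _ (syl_pos _), syl_succ, add_comm]
  | succ n h ih =>
    have hmul : dSj (n + 1) i = dSj n i * syl (n + 1) := by
      rw [dSj, dSj, dS_succ, Nat.div_mul_right_comm (syl_dvd_dS h)]
    have hsplit : dSj (n + 1) i + 1 = (dSj n i + 1) + dSj n i * dS n := by
      rw [hmul, syl_succ]
      ring
    rw [hsplit]
    exact dvd_add ih (Dvd.dvd.mul_left (syl_dvd_dS h) _)

/-- For every `n ≥ 0` and `0 ≤ j ≤ n`, there is no tuple of integers `(k_i)_{i ≠ j}` with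
`0 ≤ k_i ≤ s_i − 2` for all `i ≠ j` such that `∑_{i ≠ j} k_i d_{n,i} = d_{n,j} + 1`. -/
theorem no_solution_a_j_plus_one (n j : ℕ) (hj : j ≤ n) :
    ¬ ∃ k : ℕ → ℕ,
      (∀ i ∈ (Finset.range (n + 1)).erase j, k i ≤ syl i - 2) ∧
      (∑ i ∈ (Finset.range (n + 1)).erase j, k i * dSj n i) = dSj n j + 1 := by
  rintro ⟨k, hk, hsum⟩
  obtain he | ⟨i, hi⟩ := ((Finset.range (n + 1)).erase j).eq_empty_or_nonempty
  · simp [he] at hsum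
  obtain ⟨hij, hin⟩ := Finset.mem_erase.1 hi
  have hin : i ≤ n := by simpa [Nat.lt_succ_iff] using hin
  have hrest : syl i ∣ ∑ m ∈ ((Finset.range (n + 1)).erase j).erase i, k m * dSj n m := by
    refine Finset.dvd_sum fun m hm => Dvd.dvd.mul_left ?_ _
    simp only [Finset.mem_erase, Finset.mem_range] at hm
    exact syl_dvd_dSj hin (by omega) (Ne.symm hm.1)
  rw [← Finset.add_sum_erase _ _ hi] at hsum
  have hself : syl i ∣ k i * (dSj n i + 1) := Dvd.dvd.mul_left (syl_dvd_dSj_self_add_one hin) _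
  have hj' : syl i ∣ dSj n j := syl_dvd_dSj hin hj hij
  have hdvd : syl i ∣ k i + 1 := by
    have hadd := dvd_add hself hrest
    have hrw : k i * (dSj n i + 1)
        + ∑ m ∈ ((Finset.range (n + 1)).erase j).erase i, k m * dSj n m
        = dSj n j + (k i + 1) := by
      linarith
    rw [hrw] at hadd
    exact (Nat.dvd_add_right hj').1 hadd
  have hle := Nat.le_of_dvd (Nat.succ_pos _) hdvd
  have hki := hk i hi
  have htwo := (two_le_syl_and_dS_pos i).1
  omega
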